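/- (wm-basic form lemma) For each propositional statement P there is a wm-basic form P' with CP_wm ⊢ P = P', where CP_wm is CP extended with the axiom schemes (x◁a▷y)◁a▷z = x◁a▷z, x◁a▷(y◁a▷z) = x◁a▷z, ((x◁a▷y)◁b▷z)◁a▷v = (x◁b▷z)◁a▷v, and x◁a▷(y◁b▷(z◁a▷v)) = x◁a▷(y◁b▷v) for all a, b ∈ A. -/

import Mathlib

/-- Propositional statements over atoms `A`: constants `T`, `F`, an atom `a`
for each `a ∈ A`, and the ternary conditional composition
`cond x y z = x ◁ y ▷ z` (with `y` the central condition). -/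
inductive PS (A : Type) : Type where
  | tt : PS A
  | ff : PS A
  | atom : A → PS A
  | cond : PS A → PS A → PS A → PS A

/-- A valuation algebra (VA) over `A`. -/
structure VA (A : Type) where
  Val : Type
  Tv : Val
  Fv : Val
  yd : A → Val → Bool
  dv : A → Val → Val
  yd_T : ∀ a, yd a Tv = true
  yd_F : ∀ a, yd a Fv = false
  dv_T : ∀ a, dv a Tv = Tv
  dv_F : ∀ a, dv a Fv = Fv

variable {A : Type}

mutual
  /-- Evaluation `P/H` of a propositional statement over a valuation `H`. -/
  def PS.eval (V : VA A) : PS A → V.Val → Bool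
    | .tt, _ => true
    | .ff, _ => false
    | .atom a, H => V.yd a H
    | .cond p q r, H =>
        if PS.eval V q H then PS.eval V p (PS.deriv V q H)
        else PS.eval V r (PS.deriv V q H)
  /-- The generalized derivative `∂_P(H)`. -/
  def PS.deriv (V : VA A) : PS A → V.Val → V.Val
    | .tt, H => H
    | .ff, H => H
    | .atom a, H => V.dv a H
    | .cond p q r, H =>
        if PS.eval V q H then PS.deriv V p (PS.deriv V q H)
        else PS.deriv V r (PS.deriv V q H)
end

/-- `K`-equivalence: equal evaluation results in all members of the class `K`. -/
def KEquiv (K : VA A → Prop) (P Q : PS A) : Prop :=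
  ∀ V : VA A, K V → ∀ H : V.Val, PS.eval V P H = PS.eval V Q H

/-- A congruence with respect to conditional composition. -/
def IsCondCongruence (R : PS A → PS A → Prop) : Prop :=
  Equivalence R ∧
    ∀ ⦃x x' y y' z z' : PS A⦄, R x x' → R y y' → R z z' →
      R (PS.cond x y z) (PS.cond x' y' z')

/-- `K`-congruence: the largest congruence contained in `K`-equivalence. -/
def KCong (K : VA A → Prop) (P Q : PS A) : Prop :=
  ∃ R : PS A → PS A → Prop,
    IsCondCongruence R ∧ (∀ x y, R x y → KEquiv K x y) ∧ R P Q

/-- Derivability (of closed equations) in equational logic from the axioms `CP`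
together with an additional set `Ax` of equational axioms. -/
inductive Deriv (Ax : PS A → PS A → Prop) : PS A → PS A → Prop where
  | ax {p q} : Ax p q → Deriv Ax p q
  | cp1 (x y) : Deriv Ax (.cond x .tt y) x
  | cp2 (x y) : Deriv Ax (.cond x .ff y) y
  | cp3 (x) : Deriv Ax (.cond .tt x .ff) x
  | cp4 (x y z u v) :
      Deriv Ax (.cond x (.cond y z u) v)
               (.cond (.cond x y v) z (.cond x u v))
  | refl (x) : Deriv Ax x x
  | symm {p q} : Deriv Ax p q → Deriv Ax q p
  | trans {p q r} : Deriv Ax p q → Deriv Ax q r → Deriv Ax p r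
  | congr {x x' y y' z z'} : Deriv Ax x x' → Deriv Ax y y' → Deriv Ax z z' →
      Deriv Ax (.cond x y z) (.cond x' y' z')

/-- No additional axioms: plain `CP`. -/
def NoAx : PS A → PS A → Prop := fun _ _ => False

/-- The class `fr` of free valuation algebras: all VAs. -/
def frK : VA A → Prop := fun _ => True

/-- The class `rp` of repetition-proof VAs. -/
def rpK (V : VA A) : Prop :=
  ∀ (a : A) (x : V.Val), V.yd a x = V.yd a (V.dv a x)

/-- The class `cr` of contractive VAs. -/
def crK (V : VA A) : Prop :=
  rpK V ∧ ∀ (a : A) (x : V.Val), V.dv a (V.dv a x) = V.dv a x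

/-- The class `wm` of weakly memorizing VAs. -/
def wmK (V : VA A) : Prop :=
  crK V ∧ ∀ (a b : A) (x : V.Val),
    V.yd b (V.dv a x) = V.yd a x →
      V.dv a (V.dv b (V.dv a x)) = V.dv b (V.dv a x) ∧
      V.yd a (V.dv b (V.dv a x)) = V.yd a x

/-- The class `mem` of memorizing VAs. -/
def memK (V : VA A) : Prop :=
  crK V ∧ ∀ (a b : A) (x : V.Val),
    V.dv a (V.dv b (V.dv a x)) = V.dv b (V.dv a x) ∧
    V.yd a (V.dv b (V.dv a x)) = V.yd a x

/-- The class `st` of static VAs. -/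
def stK (V : VA A) : Prop :=
  ∀ (a b : A) (x : V.Val), V.yd a (V.dv b x) = V.yd a x

/-- The atoms occurring at left-hand (positive) positions of a basic form:
`pos(T) = pos(F) = ∅` and `pos(P◁a▷Q) = {a} ∪ pos(P)`. -/
def PS.pos {A : Type} : PS A → Set A
  | .cond p (.atom a) _ => {a} ∪ p.pos
  | _ => ∅

/-- The atoms occurring at right-hand (negative) positions of a basic form:
`neg(T) = neg(F) = ∅` and `neg(P◁a▷Q) = {a} ∪ neg(Q)`. -/
def PS.negs {A : Type} : PS A → Set A
  | .cond _ (.atom a) q => {a} ∪ q.negs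
  | _ => ∅

/-- wm-basic forms: `T`, `F`, or `P ◁ a ▷ Q` where `P` and `Q` are wm-basic
forms and `a ∉ pos(P) ∪ neg(Q)`. -/
inductive WmBasic {A : Type} : PS A → Prop where
  | tt : WmBasic .tt
  | ff : WmBasic .ff
  | cond {p q : PS A} (a : A) :
      WmBasic p → WmBasic q → a ∉ p.pos ∪ q.negs →
      WmBasic (.cond p (.atom a) q)

/-- The axiom schemes of `CP_wm` beyond `CP`: `(CPcr1)`, `(CPcr2)`,
`(CPwm1)` and `(CPwm2)` (for `a, b ∈ A`). -/
inductive WmAx {A : Type} : PS A → PS A → Prop where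
  | cr1 (a : A) (x y z : PS A) :
      WmAx (.cond (.cond x (.atom a) y) (.atom a) z)
           (.cond x (.atom a) z)
  | cr2 (a : A) (x y z : PS A) :
      WmAx (.cond x (.atom a) (.cond y (.atom a) z))
           (.cond x (.atom a) z)
  | wm1 (a b : A) (x y z v : PS A) :
      WmAx (.cond (.cond (.cond x (.atom a) y) (.atom b) z) (.atom a) v)
           (.cond (.cond x (.atom b) z) (.atom a) v)
  | wm2 (a b : A) (x y z v : PS A) :
      WmAx (.cond x (.atom a) (.cond y (.atom b) (.cond z (.atom a) v)))
           (.cond x (.atom a) (.cond y (.atom b) v))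

/-- Under a central condition `a`, the atom `a` can be removed from all positive positions of the
left argument. -/
theorem WmBasic.exists_pos_erase {P : PS A} (hP : WmBasic P) (a : A) :
    ∃ P' : PS A, WmBasic P' ∧ P'.pos ⊆ P.pos \ {a} ∧
      ∀ v, Deriv WmAx (.cond P (.atom a) v) (.cond P' (.atom a) v) := by
  induction hP with
  | tt => exact ⟨.tt, .tt, by simp [PS.pos], fun v => .refl _⟩
  | ff => exact ⟨.ff, .ff, by simp [PS.pos], fun v => .refl _⟩
  | @cond p q b _ hq hb ihp _ =>
    obtain ⟨s, hp', hsub, hd⟩ := ihp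
    by_cases hba : b = a
    · subst hba
      refine ⟨s, hp', fun x hx => ?_, fun v => (Deriv.ax (.cr1 b p q v)).trans (hd v)⟩
      exact ⟨Or.inr (hsub hx).1, (hsub hx).2⟩
    · refine ⟨.cond s (.atom b) q, .cond b hp' hq ?_, ?_, fun v => ?_⟩
      · rintro (h | h)
        · exact hb (Or.inl (hsub h).1)
        · exact hb (Or.inr h)
      · rintro x (rfl | hx)
        · exact ⟨Or.inl rfl, hba⟩
        · exact ⟨Or.inr (hsub hx).1, (hsub hx).2⟩
      · exact (Deriv.ax (.wm1 a b p .tt q v)).symm.trans <|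
          (Deriv.congr (.congr (hd .tt) (.refl _) (.refl _)) (.refl _) (.refl _)).trans <|
          .ax (.wm1 a b s .tt q v)

/-- Under a central condition `a`, the atom `a` can be removed from all negative positions of the
right argument. -/
theorem WmBasic.exists_negs_erase {P : PS A} (hP : WmBasic P) (a : A) :
    ∃ P' : PS A, WmBasic P' ∧ P'.negs ⊆ P.negs \ {a} ∧
      ∀ x, Deriv WmAx (.cond x (.atom a) P) (.cond x (.atom a) P') := by
  induction hP with
  | tt => exact ⟨.tt, .tt, by simp [PS.negs], fun x => .refl _⟩
  | ff => exact ⟨.ff, .ff, by simp [PS.negs], fun x => .refl _⟩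
  | @cond p q b hp _ hb _ ihq =>
    obtain ⟨s, hq', hsub, hd⟩ := ihq
    by_cases hba : b = a
    · subst hba
      refine ⟨s, hq', fun x hx => ?_, fun x => (Deriv.ax (.cr2 b x p q)).trans (hd x)⟩
      exact ⟨Or.inr (hsub hx).1, (hsub hx).2⟩
    · refine ⟨.cond p (.atom b) s, .cond b hp hq' ?_, ?_, fun x => ?_⟩
      · rintro (h | h)
        · exact hb (Or.inl h)
        · exact hb (Or.inr (hsub h).1)
      · rintro x (rfl | hx)
        · exact ⟨Or.inl rfl, hba⟩
        · exact ⟨Or.inr (hsub hx).1, (hsub hx).2⟩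
      · exact (Deriv.ax (.wm2 a b x p .tt q)).symm.trans <|
          (Deriv.congr (.refl _) (.refl _) (.congr (.refl _) (.refl _) (hd .tt))).trans <|
          .ax (.wm2 a b x p .tt s)

theorem WmBasic.exists_cond_atom {p q : PS A} (hp : WmBasic p) (hq : WmBasic q) (a : A) :
    ∃ P' : PS A, WmBasic P' ∧ Deriv WmAx (.cond p (.atom a) q) P' := by
  obtain ⟨p', hp', hpos, hdp⟩ := hp.exists_pos_erase a
  obtain ⟨q', hq', hneg, hdq⟩ := hq.exists_negs_erase a
  refine ⟨.cond p' (.atom a) q', .cond a hp' hq' ?_, (hdp q).trans (hdq p')⟩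
  rintro (h | h)
  · exact (hpos h).2 rfl
  · exact (hneg h).2 rfl

theorem WmBasic.exists_cond {p q r : PS A} (hp : WmBasic p) (hq : WmBasic q) (hr : WmBasic r) :
    ∃ P' : PS A, WmBasic P' ∧ Deriv WmAx (.cond p q r) P' := by
  induction hq with
  | tt => exact ⟨p, hp, .cp1 _ _⟩
  | ff => exact ⟨r, hr, .cp2 _ _⟩
  | @cond q₁ q₂ a _ _ _ ih₁ ih₂ =>
    obtain ⟨s, hs, hds⟩ := ih₁
    obtain ⟨t, ht, hdt⟩ := ih₂
    obtain ⟨P', hP', hd⟩ := hs.exists_cond_atom ht a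
    exact ⟨P', hP', (Deriv.cp4 _ _ _ _ _).trans ((Deriv.congr hds (.refl _) hdt).trans hd)⟩

/-- **wm-basic form lemma**: each propositional statement is provably equal in
`CP_wm` to a wm-basic form. -/
theorem exists_wm_basic_form {A : Type} [Countable A] [Nontrivial A]
    (P : PS A) : ∃ P' : PS A, WmBasic P' ∧ Deriv WmAx P P' := by
  induction P with
  | tt => exact ⟨.tt, .tt, .refl _⟩
  | ff => exact ⟨.ff, .ff, .refl _⟩
  | atom a =>
    exact ⟨.cond .tt (.atom a) .ff, .cond a .tt .ff (by simp [PS.pos, PS.negs]),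
      (Deriv.cp3 _).symm⟩
  | cond p q r ihp ihq ihr =>
    obtain ⟨p', hp, hdp⟩ := ihp
    obtain ⟨q', hq, hdq⟩ := ihq
    obtain ⟨r', hr, hdr⟩ := ihr
    obtain ⟨P', hP', hd⟩ := hp.exists_cond hq hr
    exact ⟨P', hP', (Deriv.congr hdp hdq hdr).trans hd⟩
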